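/- There exists a universal constant c > 0 such that for every η > 0 there exists d₀ with the following property: for all d ≥ d₀ and all positive integers m ≤ c·d²/log⁴(d), if v⁽¹⁾, …, v⁽ᵐ⁾ are i.i.d. uniformly random points on the unit sphere S^{d−1} ⊆ ℝ^d and A* is the m×m matrix with A*_{i,i} = 0 and A*_{i,j} = Σ_{k=1}^d ((v⁽ⁱ⁾_k)² − 1/d)·((v⁽ʲ⁾_k)² − 1/d) for i ≠ j, then Pr(‖A*‖₂ ≤ 1/4) ≥ 1 − η. -/

import Mathlib

open MeasureTheory Metric ProbabilityTheory

/-- The uniform (rotation-invariant) probability distribution on the unit sphere of `ℝ^d`,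
viewed as a measure on the ambient space. -/
noncomputable def uniformSphere (d : ℕ) : Measure (EuclideanSpace ℝ (Fin d)) :=
  ((volume : Measure (EuclideanSpace ℝ (Fin d))).toSphere Set.univ)⁻¹ •
    Measure.map Subtype.val ((volume : Measure (EuclideanSpace ℝ (Fin d))).toSphere)

/-- The operator (spectral) norm of a real matrix, i.e. the `ℓ² → ℓ²` operator norm. -/
noncomputable def opNorm {n : ℕ} (A : Matrix (Fin n) (Fin n) ℝ) : ℝ :=
  ‖LinearMap.toContinuousLinearMap (Matrix.toEuclideanLin A)‖

open scoped ENNReal NNReal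

lemma lintegral_pi_prod_eq_prod {ι Ω : Type*} [Fintype ι] [MeasurableSpace Ω]
    (μ : ι → Measure Ω) [∀ i, IsProbabilityMeasure (μ i)] {f : ι → Ω → ℝ≥0∞}
    (hf : ∀ i, Measurable (f i)) :
    ∫⁻ x, ∏ i, f i (x i) ∂Measure.pi μ = ∏ i, ∫⁻ y, f i y ∂μ i := by
  rw [lintegral_prod_eq_prod_lintegral_of_indepFun Finset.univ
    (fun i (x : ι → Ω) => f i (x i)) (iIndepFun_pi fun i => (hf i).aemeasurable)
    fun i => (hf i).comp (measurable_pi_apply i)]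
  exact Finset.prod_congr rfl fun i _ => (measurePreserving_eval μ i).lintegral_comp (hf i)

/-- The product density formula: a finite product of probability measures with nonvanishing
densities `f i` has density `∏ i, f i (x i)`. -/
lemma pi_withDensity_of_isProbabilityMeasure {ι : Type*} [Fintype ι] {f : ι → ℝ → ℝ≥0∞}
    (hf : ∀ i, Measurable (f i)) (h0 : ∀ i x, f i x ≠ 0) (htop : ∀ i x, f i x ≠ ∞)
    [∀ i, IsProbabilityMeasure ((volume : Measure ℝ).withDensity (f i))] :
    Measure.pi (fun i => (volume : Measure ℝ).withDensity (f i)) =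
      (volume : Measure (ι → ℝ)).withDensity (fun x => ∏ i, f i (x i)) := by
  set ν := Measure.pi (fun i => (volume : Measure ℝ).withDensity (f i))
  have hvol : (volume : Measure (ι → ℝ)) = ν.withDensity (fun x => ∏ i, f i (x i))⁻¹ := by
    refine Measure.pi_eq fun s hs => ?_
    rw [withDensity_apply _ (MeasurableSet.univ_pi hs), ← lintegral_indicator
      (MeasurableSet.univ_pi hs)]
    have key : ∀ x : ι → ℝ, (Set.univ.pi s).indicator (fun x => ∏ i, f i (x i))⁻¹ x =
        ∏ i, (s i).indicator (f i)⁻¹ (x i) := by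
      intro x
      by_cases hx : x ∈ Set.univ.pi s
      · rw [Set.indicator_of_mem hx, Pi.inv_apply,
          ENNReal.prod_inv_distrib fun i _ j _ _ => Or.inl (h0 i _)]
        refine Finset.prod_congr rfl fun i _ => ?_
        rw [Set.indicator_of_mem (hx i trivial), Pi.inv_apply]
      · rw [Set.indicator_of_notMem hx]
        simp only [Set.mem_pi, Set.mem_univ, forall_const, not_forall] at hx
        obtain ⟨i, hi⟩ := hx
        exact (Finset.prod_eq_zero (Finset.mem_univ i) (Set.indicator_of_notMem hi _)).symm
    simp_rw [key]
    have hm : ∀ i, Measurable ((s i).indicator (f i)⁻¹) := fun i => (hf i).inv.indicator (hs i)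
    rw [lintegral_pi_prod_eq_prod _ hm]
    refine Finset.prod_congr rfl fun i _ => ?_
    rw [lintegral_indicator (hs i), ← withDensity_apply _ (hs i)]
    exact congrArg (fun μ => μ (s i))
      (withDensity_inv_same (hf i) (by simp [h0]) (by simp [htop]))
  have hF : Measurable (fun x : ι → ℝ => ∏ i, f i (x i)) := by fun_prop
  have h := withDensity_inv_same (μ := ν) hF.inv
    (Filter.Eventually.of_forall fun x =>
      ENNReal.inv_ne_zero.2 (ENNReal.prod_ne_top fun i _ => htop i _))
    (Filter.Eventually.of_forall fun x =>
      ENNReal.inv_ne_top.2 (Finset.prod_ne_zero_iff.2 fun i _ => h0 i _))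
  simp only [Pi.inv_apply, inv_inv] at h
  rw [← hvol] at h
  exact h.symm

/-- The standard Gaussian measure on `Fin d → ℝ`. -/
noncomputable abbrev stdGaussianPi (d : ℕ) : Measure (Fin d → ℝ) :=
  Measure.pi fun _ => gaussianReal 0 1

/-- The radial projection of a vector to the Euclidean unit sphere. -/
noncomputable def radialProj {d : ℕ} (g : Fin d → ℝ) : EuclideanSpace ℝ (Fin d) :=
  ‖WithLp.toLp 2 g‖⁻¹ • WithLp.toLp 2 g

lemma measurable_radialProj {d : ℕ} : Measurable (radialProj (d := d)) := by
  unfold radialProj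
  fun_prop

lemma map_toLp_stdGaussianPi (d : ℕ) :
    ∃ F : ℝ → ℝ≥0∞, Measurable F ∧ (stdGaussianPi d).map (WithLp.toLp 2) =
      (volume : Measure (EuclideanSpace ℝ (Fin d))).withDensity (fun x => F ‖x‖) := by
  refine ⟨fun r => ENNReal.ofReal ((√(2 * Real.pi * (1 : ℝ≥0)))⁻¹ ^ d * Real.exp (-r ^ 2 / 2)),
    by fun_prop, ?_⟩
  have : IsProbabilityMeasure ((volume : Measure ℝ).withDensity (gaussianPDF 0 1)) := by
    rw [← gaussianReal_of_var_ne_zero _ one_ne_zero]; infer_instance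
  have h := pi_withDensity_of_isProbabilityMeasure (ι := Fin d) (f := fun _ => gaussianPDF 0 1)
    (fun _ => measurable_gaussianPDF 0 1) (fun _ x => (gaussianPDF_pos 0 one_ne_zero x).ne')
    (fun _ x => gaussianPDF_ne_top)
  rw [stdGaussianPi, gaussianReal_of_var_ne_zero _ one_ne_zero, h]
  ext s hs
  have hm : Measurable (WithLp.toLp 2 : (Fin d → ℝ) → EuclideanSpace ℝ (Fin d)) := by fun_prop
  rw [Measure.map_apply hm hs, withDensity_apply _ (hm hs), withDensity_apply _ hs,
    ← (PiLp.volume_preserving_toLp (Fin d)).setLIntegral_comp_preimage hs (by fun_prop)]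
  refine lintegral_congr fun x => ?_
  simp only [gaussianPDF, gaussianPDFReal]
  rw [← ENNReal.ofReal_prod_of_nonneg (fun i _ => by positivity), Finset.prod_mul_distrib,
    ← Real.exp_sum, EuclideanSpace.norm_sq_eq]
  simp [← Finset.sum_div]

/-- The radial projection of a standard Gaussian vector is uniformly distributed on the sphere. -/
lemma map_radialProj_stdGaussianPi {d : ℕ} (hd : 1 ≤ d) :
    (stdGaussianPi d).map radialProj = uniformSphere d := by
  have : NeZero d := ⟨by omega⟩
  set E := EuclideanSpace ℝ (Fin d)
  obtain ⟨F, hF, hmap⟩ := map_toLp_stdGaussianPi d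
  set μ : Measure E := volume
  set c : ℝ≥0∞ := ∫⁻ r, F r.1 ∂(Measure.volumeIoiPow (Module.finrank ℝ E - 1))
  have hm : Measurable (WithLp.toLp 2 : (Fin d → ℝ) → E) := by fun_prop
  have hN : Measurable (fun x : E => ‖x‖⁻¹ • x) := by fun_prop
  have main : ∀ s : Set E, MeasurableSet s → (stdGaussianPi d).map radialProj s =
      μ.toSphere (Subtype.val ⁻¹' s) * c := by
    intro s hs
    have h1 : (stdGaussianPi d).map radialProj =
        ((stdGaussianPi d).map (WithLp.toLp 2)).map (fun x : E => ‖x‖⁻¹ • x) := by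
      rw [Measure.map_map hN hm]; rfl
    rw [h1, hmap, Measure.map_apply hN hs, withDensity_apply _ (hN hs),
      ← lintegral_indicator (hN hs)]
    set G : E → ℝ≥0∞ := ((fun x : E => ‖x‖⁻¹ • x) ⁻¹' s).indicator (fun x => F ‖x‖)
    have h2 : ∫⁻ x, G x ∂μ = ∫⁻ x : ({0}ᶜ : Set E), G x ∂(μ.comap (↑)) := by
      rw [lintegral_subtype_comap (measurableSet_singleton _).compl, restrict_compl_singleton]
    rw [h2]
    set H : sphere (0 : E) 1 × Set.Ioi (0 : ℝ) → ℝ≥0∞ := fun p =>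
      (Subtype.val ⁻¹' s).indicator 1 p.1 * F p.2.1
    have h3 : ∀ x : ({0}ᶜ : Set E), G x = H (homeomorphUnitSphereProd E x) := by
      intro x
      have hx : x.1 ∈ (fun x : E => ‖x‖⁻¹ • x) ⁻¹' s ↔
          (homeomorphUnitSphereProd E x).1 ∈ (Subtype.val ⁻¹' s : Set (sphere (0 : E) 1)) := by
        simp
      by_cases h : x.1 ∈ (fun x : E => ‖x‖⁻¹ • x) ⁻¹' s
      · simp only [G, H, Set.indicator_of_mem h, Set.indicator_of_mem (hx.1 h)]
        simp
      · simp only [G, H, Set.indicator_of_notMem h, Set.indicator_of_notMem (mt hx.2 h), zero_mul]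
    simp_rw [h3]
    have hs' : MeasurableSet (Subtype.val ⁻¹' s : Set (sphere (0 : E) 1)) :=
      measurable_subtype_coe hs
    have hi : Measurable ((Subtype.val ⁻¹' s : Set (sphere (0 : E) 1)).indicator
      (1 : sphere (0 : E) 1 → ℝ≥0∞)) := measurable_one.indicator hs'
    have hH : Measurable H := by fun_prop
    rw [(μ.measurePreserving_homeomorphUnitSphereProd).lintegral_comp hH,
      lintegral_prod_mul hi.aemeasurable
        (g := fun r : Set.Ioi (0 : ℝ) => F r.1) (by fun_prop), lintegral_indicator_one hs']
  have huniv := main Set.univ MeasurableSet.univ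
  have : IsProbabilityMeasure ((stdGaussianPi d).map radialProj) :=
    Measure.isProbabilityMeasure_map measurable_radialProj.aemeasurable
  rw [measure_univ, Set.preimage_univ] at huniv
  have hc : c = (μ.toSphere Set.univ)⁻¹ :=
    ENNReal.eq_inv_of_mul_eq_one_left (by rw [mul_comm, ← huniv])
  ext s hs
  rw [main s hs, hc, uniformSphere, Measure.smul_apply, Measure.map_apply measurable_subtype_coe hs,
    smul_eq_mul, mul_comm]

section IndependentSums

variable {Ω ι : Type*} [MeasurableSpace Ω] {μ : Measure Ω} [IsProbabilityMeasure μ]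
  {Y : ι → Ω → ℝ}

lemma integral_sum_sq_of_iIndepFun (hind : iIndepFun Y μ) (hY : ∀ i, MemLp (Y i) 2 μ)
    (h0 : ∀ i, ∫ ω, Y i ω ∂μ = 0) (s : Finset ι) :
    ∫ ω, (∑ i ∈ s, Y i ω) ^ 2 ∂μ = ∑ i ∈ s, ∫ ω, Y i ω ^ 2 ∂μ := by
  have h := IndepFun.variance_sum (s := s) (fun i _ => hY i) fun i _ j _ hij => hind.indepFun hij
  have hS : MemLp (∑ i ∈ s, Y i) 2 μ := memLp_finsetSum' s fun i _ => hY i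
  have hS0 : ∫ ω, (∑ i ∈ s, Y i) ω ∂μ = 0 := by
    simp only [Finset.sum_apply]
    rw [integral_finsetSum _ fun i _ => (hY i).integrable one_le_two]
    simp [h0]
  rw [variance_of_integral_eq_zero hS.aemeasurable hS0] at h
  simp only [Finset.sum_apply] at h
  rw [h]
  exact Finset.sum_congr rfl fun i _ => variance_of_integral_eq_zero (hY i).aemeasurable (h0 i)

lemma MeasureTheory.MemLp.integrable_pow_of_le {f : Ω → ℝ} {n k : ℕ} (hf : MemLp f n μ)
    (hk : k ≤ n) :
    Integrable (fun ω => f ω ^ k) μ := by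
  have h : MemLp f k μ := hf.mono_exponent (by exact_mod_cast hk)
  refine (integrable_norm_iff (hf.aestronglyMeasurable.pow k)).1 ?_
  simpa [norm_pow] using h.integrable_norm_pow'

lemma integral_sum_pow_four_le (hind : iIndepFun Y μ) (hm : ∀ i, Measurable (Y i))
    (hY : ∀ i, MemLp (Y i) 4 μ) (h0 : ∀ i, ∫ ω, Y i ω ∂μ = 0) {B : ℝ}
    (h2 : ∀ i, ∫ ω, Y i ω ^ 2 ∂μ ≤ B) (h4 : ∀ i, ∫ ω, Y i ω ^ 4 ∂μ ≤ B ^ 2) (s : Finset ι) :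
    ∫ ω, (∑ i ∈ s, Y i ω) ^ 4 ∂μ ≤ 3 * B ^ 2 * (s.card : ℝ) ^ 2 := by
  classical
  induction s using Finset.induction_on with
  | empty => simp
  | insert a s ha ih =>
    set S : Ω → ℝ := ∑ i ∈ s, Y i
    have hSL : MemLp S (4 : ℕ) μ := memLp_finsetSum' s fun i _ => hY i
    have hYL : MemLp (Y a) (4 : ℕ) μ := hY a
    have hSY : IndepFun S (Y a) μ := hind.indepFun_finsetSum_of_notMem hm ha
    have hpow : ∀ k l : ℕ, IndepFun (fun ω => S ω ^ k) (fun ω => Y a ω ^ l) μ := fun k l =>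
      hSY.comp (φ := fun x => x ^ k) (ψ := fun x => x ^ l) (by fun_prop) (by fun_prop)
    have hi : ∀ k l : ℕ, k ≤ 4 → l ≤ 4 → Integrable (fun ω => S ω ^ k * Y a ω ^ l) μ :=
      fun k l hk hl =>
        (hpow k l).integrable_mul (hSL.integrable_pow_of_le hk) (hYL.integrable_pow_of_le hl)
    have hmul : ∀ k l : ℕ, k ≤ 4 → l ≤ 4 → ∫ ω, S ω ^ k * Y a ω ^ l ∂μ =
        (∫ ω, S ω ^ k ∂μ) * ∫ ω, Y a ω ^ l ∂μ := fun k l hk hl =>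
      (hpow k l).integral_fun_mul_eq_mul_integral
        (hSL.integrable_pow_of_le hk).aestronglyMeasurable
        (hYL.integrable_pow_of_le hl).aestronglyMeasurable
    have hexp : ∀ ω, (∑ i ∈ insert a s, Y i ω) ^ 4 = S ω ^ 4 * Y a ω ^ 0
        + 4 * (S ω ^ 3 * Y a ω ^ 1) + 6 * (S ω ^ 2 * Y a ω ^ 2) + 4 * (S ω ^ 1 * Y a ω ^ 3)
        + S ω ^ 0 * Y a ω ^ 4 := by
      intro ω
      rw [Finset.sum_insert ha, ← Finset.sum_apply ω s Y]
      ring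
    simp_rw [hexp]
    have i1 := hi 4 0 le_rfl (by norm_num)
    have i2 := (hi 3 1 (by norm_num) (by norm_num)).const_mul 4
    have i3 := (hi 2 2 (by norm_num) (by norm_num)).const_mul 6
    have i4 := (hi 1 3 (by norm_num) (by norm_num)).const_mul 4
    have i5 := hi 0 4 (by norm_num) le_rfl
    rw [integral_add ?_ i5, integral_add ?_ i4, integral_add ?_ i3, integral_add i1 i2]
    rotate_left
    · exact i1.add i2
    · exact (i1.add i2).add i3
    · exact ((i1.add i2).add i3).add i4
    simp only [integral_const_mul]
    rw [hmul 4 0 le_rfl (by norm_num), hmul 3 1 (by norm_num) (by norm_num),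
      hmul 2 2 (by norm_num) (by norm_num), hmul 1 3 (by norm_num) (by norm_num),
      hmul 0 4 (by norm_num) le_rfl]
    have hY2 : ∀ i, MemLp (Y i) 2 μ := fun i => (hY i).mono_exponent (by norm_num)
    have hS1 : ∫ ω, S ω ∂μ = 0 := by
      simp only [S, Finset.sum_apply]
      rw [integral_finsetSum _ fun i _ => (hY2 i).integrable one_le_two]
      simp [h0]
    have hS2 : ∫ ω, S ω ^ 2 ∂μ ≤ s.card * B := by
      simp only [S, Finset.sum_apply]
      rw [integral_sum_sq_of_iIndepFun hind hY2 h0]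
      calc _ ≤ ∑ i ∈ s, B := Finset.sum_le_sum fun i _ => h2 i
        _ = _ := by simp
    have hS20 : 0 ≤ ∫ ω, S ω ^ 2 ∂μ := integral_nonneg fun ω => sq_nonneg _
    have hYa0 : 0 ≤ ∫ ω, Y a ω ^ 2 ∂μ := integral_nonneg fun ω => sq_nonneg _
    have hprod : (∫ ω, S ω ^ 2 ∂μ) * ∫ ω, Y a ω ^ 2 ∂μ ≤ s.card * B * B :=
      mul_le_mul hS2 (h2 a) hYa0 (hS20.trans hS2)
    simp only [← Finset.sum_apply] at ih
    simp only [pow_one, pow_zero, h0, hS1, integral_const, probReal_univ, smul_eq_mul]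
    rw [Finset.card_insert_of_notMem ha]
    push_cast
    nlinarith [h4 a, sq_nonneg B]

end IndependentSums

lemma memLp_pow_gaussianReal (n : ℕ) (p : ℝ≥0) :
    MemLp (fun x : ℝ => x ^ n) p (gaussianReal 0 1) := by
  induction n generalizing p with
  | zero => simpa using memLp_const (1 : ℝ)
  | succ n ih =>
    have h1 := ih (2 * p)
    have h2 : MemLp (fun x : ℝ => x) (2 * p : ℝ≥0) (gaussianReal 0 1) :=
      memLp_id_gaussianReal (2 * p)
    have : ENNReal.HolderTriple ((2 * p : ℝ≥0) : ℝ≥0∞) ((2 * p : ℝ≥0) : ℝ≥0∞) (p : ℝ≥0∞) := by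
      constructor
      rw [ENNReal.coe_mul, ENNReal.coe_ofNat,
        ENNReal.mul_inv (by simp) (by simp), ← add_mul, ENNReal.inv_two_add_inv_two, one_mul]
    simpa only [pow_succ] using h2.mul' h1

section Coordinates

variable {f : ℝ → ℝ}

lemma integral_coord_stdGaussianPi {d : ℕ} (hf : AEStronglyMeasurable f (gaussianReal 0 1))
    (i : Fin d) :
    ∫ x, f (x i) ∂stdGaussianPi d = ∫ y, f y ∂gaussianReal 0 1 :=
  integral_comp_eval (μ := fun _ : Fin d => gaussianReal 0 1) hf

lemma exists_tail_bound_sum_stdGaussianPi (hfm : Measurable f) (hf : MemLp f 4 (gaussianReal 0 1))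
    (h0 : ∫ y, f y ∂gaussianReal 0 1 = 0) :
    ∃ K : ℝ, 0 ≤ K ∧ ∀ d : ℕ, 1 ≤ d → stdGaussianPi d {x | (d : ℝ) / 2 ≤ |∑ i, f (x i)|} ≤
      ENNReal.ofReal (K / d ^ 2) := by
  set B : ℝ := 1 + ∫ y, f y ^ 2 ∂gaussianReal 0 1 + ∫ y, f y ^ 4 ∂gaussianReal 0 1
  have hq2 : 0 ≤ ∫ y, f y ^ 2 ∂gaussianReal 0 1 := integral_nonneg fun _ => sq_nonneg _
  have hq4 : 0 ≤ ∫ y, f y ^ 4 ∂gaussianReal 0 1 := integral_nonneg fun _ => by positivity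
  refine ⟨48 * B ^ 2, by positivity, fun d hd => ?_⟩
  have hdpos : (0 : ℝ) < d := by exact_mod_cast hd
  set Y : Fin d → (Fin d → ℝ) → ℝ := fun i x => f (x i)
  have hind : iIndepFun Y (stdGaussianPi d) := iIndepFun_pi fun _ => hfm.aemeasurable
  have hYm : ∀ i, Measurable (Y i) := fun i => hfm.comp (measurable_pi_apply i)
  have hY : ∀ i, MemLp (Y i) 4 (stdGaussianPi d) := fun i =>
    hf.comp_measurePreserving (measurePreserving_eval (fun _ : Fin d => gaussianReal 0 1) i)
  have hmom := integral_sum_pow_four_le hind hYm hY (B := B)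
    (fun i => (integral_coord_stdGaussianPi hf.1 i).trans h0)
    (fun i => (integral_coord_stdGaussianPi (f := fun y => f y ^ 2) (by fun_prop) i).trans_le
      (by simp only [B]; linarith))
    (fun i => (integral_coord_stdGaussianPi (f := fun y => f y ^ 4) (by fun_prop) i).trans_le
      (by simp only [B]; nlinarith)) Finset.univ
  have hint : Integrable (fun x => (∑ i, Y i x) ^ 4) (stdGaussianPi d) :=
    MemLp.integrable_pow_of_le (n := 4) (memLp_finsetSum _ fun i _ => hY i) le_rfl
  have hnonneg : 0 ≤ᵐ[stdGaussianPi d] fun x => (∑ i, Y i x) ^ 4 :=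
    Filter.Eventually.of_forall fun x => (by decide : Even 4).pow_nonneg (∑ i, Y i x)
  have hmk := mul_meas_ge_le_integral_of_nonneg hnonneg hint (((d : ℝ) / 2) ^ 4)
  rw [Finset.card_univ, Fintype.card_fin] at hmom
  calc stdGaussianPi d {x | (d : ℝ) / 2 ≤ |∑ i, f (x i)|}
      ≤ stdGaussianPi d {x | ((d : ℝ) / 2) ^ 4 ≤ (∑ i, Y i x) ^ 4} := by
        refine measure_mono fun x hx => ?_
        have h : ((d : ℝ) / 2) ^ 4 ≤ |∑ i, f (x i)| ^ 4 := pow_le_pow_left₀ (by positivity) hx 4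
        rwa [(by decide : Even 4).pow_abs] at h
    _ = ENNReal.ofReal ((stdGaussianPi d).real {x | ((d : ℝ) / 2) ^ 4 ≤ (∑ i, Y i x) ^ 4}) := by
        rw [ofReal_measureReal]
    _ ≤ ENNReal.ofReal (48 * B ^ 2 / d ^ 2) := by
        refine ENNReal.ofReal_le_ofReal ?_
        have h : (stdGaussianPi d).real {x | ((d : ℝ) / 2) ^ 4 ≤ (∑ i, Y i x) ^ 4} ≤
            3 * B ^ 2 * d ^ 2 / ((d : ℝ) / 2) ^ 4 :=
          (le_div_iff₀' (by positivity)).2 (hmk.trans hmom)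
        refine h.trans_eq ?_
        field_simp
        ring

end Coordinates

/-- The vector of centered squared coordinates `v k ^ 2 - 1 / d`. -/
noncomputable def centeredSq {d : ℕ} (v : EuclideanSpace ℝ (Fin d)) : EuclideanSpace ℝ (Fin d) :=
  WithLp.toLp 2 fun k => v k ^ 2 - 1 / (d : ℝ)

lemma measurable_centeredSq {d : ℕ} : Measurable (centeredSq (d := d)) := by
  unfold centeredSq
  fun_prop

lemma centeredSq_radialProj_apply {d : ℕ} (g : Fin d → ℝ) (k : Fin d) :
    centeredSq (radialProj g) k = g k ^ 2 / (∑ i, g i ^ 2) - 1 / d := by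
  simp only [centeredSq, radialProj, PiLp.smul_apply, smul_eq_mul, mul_pow, inv_pow,
    EuclideanSpace.norm_sq_eq, Real.norm_eq_abs, sq_abs]
  ring

lemma norm_sq_centeredSq_radialProj_le {d : ℕ} {g : Fin d → ℝ} (hd : 1 ≤ d)
    (hg : 0 < ∑ i, g i ^ 2) :
    ‖centeredSq (radialProj g)‖ ^ 2 ≤ (∑ i, g i ^ 4) / (∑ i, g i ^ 2) ^ 2 := by
  have hd0 : (d : ℝ) ≠ 0 := by positivity
  rw [EuclideanSpace.norm_sq_eq]
  simp only [centeredSq_radialProj_apply, Real.norm_eq_abs, sq_abs]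
  set N := ∑ i, g i ^ 2
  have h : ∑ k, (g k ^ 2 / N - 1 / d) ^ 2 = (∑ i, g i ^ 4) / N ^ 2 - 1 / d := by
    calc ∑ k, (g k ^ 2 / N - 1 / d) ^ 2
        = ∑ k, (g k ^ 4 / N ^ 2 - 2 / (d * N) * g k ^ 2 + 1 / d ^ 2) := by
          refine Finset.sum_congr rfl fun k _ => ?_
          field_simp
          ring
      _ = (∑ i, g i ^ 4) / N ^ 2 - 2 / (d * N) * N + d * (1 / d ^ 2) := by
          rw [Finset.sum_add_distrib, Finset.sum_sub_distrib, ← Finset.sum_div, ← Finset.mul_sum]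
          simp [N]
      _ = _ := by field_simp; ring
  rw [h]
  have : (0 : ℝ) ≤ 1 / d := by positivity
  linarith

lemma inner_centeredSq_radialProj {d : ℕ} {g : Fin d → ℝ} (hd : 1 ≤ d) (hg : 0 < ∑ i, g i ^ 2)
    (u : EuclideanSpace ℝ (Fin d)) :
    ∑ k, centeredSq (radialProj g) k * u k =
      (∑ k, (u k - (∑ i, u i) / d) * (g k ^ 2 - 1)) / ∑ i, g i ^ 2 := by
  have hd0 : (d : ℝ) ≠ 0 := by positivity
  simp only [centeredSq_radialProj_apply]
  set N := ∑ i, g i ^ 2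
  set U := ∑ i, u i
  have h1 : ∑ k, (g k ^ 2 / N - 1 / d) * u k = (∑ k, g k ^ 2 * u k) / N - U / d := by
    simp only [sub_mul, Finset.sum_sub_distrib, div_mul_eq_mul_div,
      Finset.sum_div, one_mul, U]
  have h2 : ∑ k, (u k - U / d) * (g k ^ 2 - 1) = ∑ k, g k ^ 2 * u k - U / d * N := by
    calc _ = ∑ k, (g k ^ 2 * u k - U / d * g k ^ 2 - u k + U / d) :=
          Finset.sum_congr rfl fun k _ => by ring
      _ = ∑ k, g k ^ 2 * u k - U / d * N - U + d * (U / d) := by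
          rw [Finset.sum_add_distrib, Finset.sum_sub_distrib, Finset.sum_sub_distrib,
            ← Finset.mul_sum]
          simp [N, U]
      _ = _ := by field_simp; ring
  rw [h1, h2]
  field_simp

lemma sum_sub_mean_sq_le {d : ℕ} (u : Fin d → ℝ) :
    ∑ k, (u k - (∑ i, u i) / d) ^ 2 ≤ ∑ k, u k ^ 2 := by
  rcases Nat.eq_zero_or_pos d with rfl | hd
  · simp
  have hd0 : (d : ℝ) ≠ 0 := by positivity
  set U := ∑ i, u i
  have h : ∑ k, (u k - U / d) ^ 2 = ∑ k, u k ^ 2 - U ^ 2 / d := by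
    calc _ = ∑ k, (u k ^ 2 - 2 * U / d * u k + (U / d) ^ 2) :=
          Finset.sum_congr rfl fun k _ => by ring
      _ = ∑ k, u k ^ 2 - 2 * U / d * U + d * (U / d) ^ 2 := by
          rw [Finset.sum_add_distrib, Finset.sum_sub_distrib, ← Finset.mul_sum]
          simp [U]
      _ = _ := by field_simp; ring
  rw [h]
  have : 0 ≤ U ^ 2 / d := by positivity
  linarith

lemma integral_sq_gaussianReal : ∫ x, x ^ 2 ∂gaussianReal 0 1 = 1 := by
  have h := variance_of_integral_eq_zero (μ := gaussianReal 0 1) (X := id) (by fun_prop)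
    (by simp)
  rw [variance_id_gaussianReal] at h
  simpa using h.symm

/-- Outside an event of probability `O(d⁻²)`, the vector `centeredSq v`, for `v` uniform on the
sphere, has squared norm `O(d⁻¹)`, and its covariance restricted to this event is `O(d⁻²)`. -/
lemma exists_good_event : ∃ C K : ℝ, 0 ≤ C ∧ 0 ≤ K ∧ ∀ d : ℕ, 1 ≤ d → ∃ G : Set (Fin d → ℝ),
    MeasurableSet G ∧ stdGaussianPi d Gᶜ ≤ ENNReal.ofReal (K / d ^ 2) ∧
    (∀ g ∈ G, ‖centeredSq (radialProj g)‖ ^ 2 ≤ C / d) ∧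
    ∀ u : EuclideanSpace ℝ (Fin d),
      ∫⁻ g in G, ENNReal.ofReal ((∑ k, centeredSq (radialProj g) k * u k) ^ 2) ∂stdGaussianPi d ≤
        ENNReal.ofReal (K * ‖u‖ ^ 2 / d ^ 2) := by
  set M : ℝ := ∫ x, x ^ 4 ∂gaussianReal 0 1
  have hM : 0 ≤ M := integral_nonneg fun x => by positivity
  have hpow : ∀ n p : ℕ, MemLp (fun x : ℝ => x ^ n) p (gaussianReal 0 1) := fun n p => by
    exact_mod_cast memLp_pow_gaussianReal n p
  have hint : ∀ n : ℕ, Integrable (fun x : ℝ => x ^ n) (gaussianReal 0 1) := fun n =>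
    (hpow n 1).integrable (by simp)
  have hL2 : MemLp (fun x : ℝ => x ^ 2 - 1) 4 (gaussianReal 0 1) := (hpow 2 4).sub (memLp_const 1)
  have hL4 : MemLp (fun x : ℝ => x ^ 4 - M) 4 (gaussianReal 0 1) := (hpow 4 4).sub (memLp_const M)
  have h20 : ∫ x, (x ^ 2 - 1) ∂gaussianReal 0 1 = 0 := by
    rw [integral_sub (hint 2) (integrable_const _), integral_sq_gaussianReal]; simp
  have h40 : ∫ x, (x ^ 4 - M) ∂gaussianReal 0 1 = 0 := by
    rw [integral_sub (hint 4) (integrable_const _)]; simp [M]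
  obtain ⟨K₁, hK₁, h₁⟩ := exists_tail_bound_sum_stdGaussianPi (by fun_prop) hL2 h20
  obtain ⟨K₂, hK₂, h₂⟩ := exists_tail_bound_sum_stdGaussianPi (by fun_prop) hL4 h40
  set V : ℝ := ∫ x, (x ^ 2 - 1) ^ 2 ∂gaussianReal 0 1
  have hV : 0 ≤ V := integral_nonneg fun x => sq_nonneg _
  refine ⟨4 * (M + 1), K₁ + K₂ + 4 * V, by positivity, by positivity, fun d hd => ?_⟩
  have hdpos : (0 : ℝ) < d := by exact_mod_cast hd
  set B₁ : Set (Fin d → ℝ) := {x | (d : ℝ) / 2 ≤ |∑ i, (x i ^ 2 - 1)|}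
  set B₂ : Set (Fin d → ℝ) := {x | (d : ℝ) / 2 ≤ |∑ i, (x i ^ 4 - M)|}
  have hB₁ : MeasurableSet B₁ := measurableSet_le measurable_const (by fun_prop)
  have hB₂ : MeasurableSet B₂ := measurableSet_le measurable_const (by fun_prop)
  have hN : ∀ g ∈ (B₁ ∪ B₂)ᶜ, (d : ℝ) / 2 ≤ ∑ i, g i ^ 2 := by
    intro g hg
    have h : |∑ i, (g i ^ 2 - 1)| < (d : ℝ) / 2 := not_le.1 fun h => hg (Or.inl h)
    rw [Finset.sum_sub_distrib, abs_lt] at h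
    simp at h
    linarith [h.1]
  refine ⟨(B₁ ∪ B₂)ᶜ, (hB₁.union hB₂).compl, ?_, fun g hg => ?_, fun u => ?_⟩
  · rw [compl_compl]
    calc _ ≤ stdGaussianPi d B₁ + stdGaussianPi d B₂ := measure_union_le _ _
      _ ≤ ENNReal.ofReal (K₁ / d ^ 2) + ENNReal.ofReal (K₂ / d ^ 2) := add_le_add (h₁ d hd) (h₂ d hd)
      _ = ENNReal.ofReal (K₁ / d ^ 2 + K₂ / d ^ 2) :=
          (ENNReal.ofReal_add (by positivity) (by positivity)).symm
      _ ≤ _ := by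
          refine ENNReal.ofReal_le_ofReal ?_
          rw [← add_div]
          exact div_le_div_of_nonneg_right (by linarith) (by positivity)
  · have hNg := hN g hg
    have h4 : |∑ i, (g i ^ 4 - M)| < (d : ℝ) / 2 := not_le.1 fun h => hg (Or.inr h)
    rw [Finset.sum_sub_distrib, abs_lt] at h4
    simp at h4
    refine (norm_sq_centeredSq_radialProj_le hd (by linarith)).trans ?_
    calc (∑ i, g i ^ 4) / (∑ i, g i ^ 2) ^ 2 ≤ ((M + 1) * d) / (d / 2) ^ 2 := by
          gcongr
          nlinarith [h4.2]
      _ = _ := by field_simp; norm_num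
  · set a : Fin d → ℝ := fun k => u k - (∑ i, u i) / d
    set Y : Fin d → (Fin d → ℝ) → ℝ := fun k x => a k * (x k ^ 2 - 1)
    have hind : iIndepFun Y (stdGaussianPi d) :=
      iIndepFun_pi (X := fun k y => a k * (y ^ 2 - 1)) fun _ => by fun_prop
    have hYL : ∀ k, MemLp (Y k) 2 (stdGaussianPi d) := fun k =>
      ((hL2.mono_exponent (by norm_num)).comp_measurePreserving
        (measurePreserving_eval (fun _ : Fin d => gaussianReal 0 1) k)).const_mul (a k)
    have hY0 : ∀ k, ∫ x, Y k x ∂stdGaussianPi d = 0 := fun k => by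
      rw [integral_const_mul, integral_coord_stdGaussianPi (f := fun y => y ^ 2 - 1) (by fun_prop),
        h20, mul_zero]
    have hY2 : ∀ k, ∫ x, Y k x ^ 2 ∂stdGaussianPi d = a k ^ 2 * V := fun k => by
      simp only [Y, mul_pow]
      rw [integral_const_mul,
        integral_coord_stdGaussianPi (f := fun y => (y ^ 2 - 1) ^ 2) (by fun_prop)]
    have hsum := integral_sum_sq_of_iIndepFun hind hYL hY0 Finset.univ
    simp only [hY2, ← Finset.sum_mul] at hsum
    have hSL : MemLp (fun x => ∑ k, Y k x) 2 (stdGaussianPi d) := memLp_finsetSum _ fun k _ => hYL k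
    calc ∫⁻ g in (B₁ ∪ B₂)ᶜ, ENNReal.ofReal ((∑ k, centeredSq (radialProj g) k * u k) ^ 2)
          ∂stdGaussianPi d
        ≤ ∫⁻ g in (B₁ ∪ B₂)ᶜ, ENNReal.ofReal (4 / d ^ 2 * (∑ k, Y k g) ^ 2) ∂stdGaussianPi d := by
          refine setLIntegral_mono' (hB₁.union hB₂).compl fun g hg => ENNReal.ofReal_le_ofReal ?_
          have hNg := hN g hg
          rw [inner_centeredSq_radialProj hd (by linarith), div_pow]
          calc (∑ k, Y k g) ^ 2 / (∑ i, g i ^ 2) ^ 2 ≤ (∑ k, Y k g) ^ 2 / (d / 2) ^ 2 := by gcongr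
            _ = _ := by field_simp; norm_num
      _ ≤ ∫⁻ g, ENNReal.ofReal (4 / d ^ 2 * (∑ k, Y k g) ^ 2) ∂stdGaussianPi d :=
          setLIntegral_le_lintegral _ _
      _ = ENNReal.ofReal (4 / d ^ 2 * ((∑ k, a k ^ 2) * V)) := by
          rw [← hsum, ← integral_const_mul, ofReal_integral_eq_lintegral_ofReal]
          · exact (hSL.integrable_sq).const_mul _
          · exact Filter.Eventually.of_forall fun x => by positivity
      _ ≤ _ := by
          refine ENNReal.ofReal_le_ofReal ?_
          have h := sum_sub_mean_sq_le u
          rw [EuclideanSpace.norm_sq_eq]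
          simp only [Real.norm_eq_abs, sq_abs]
          have hu : 0 ≤ ∑ k, u k ^ 2 := Finset.sum_nonneg fun k _ => sq_nonneg _
          calc 4 / d ^ 2 * ((∑ k, a k ^ 2) * V) ≤ 4 / d ^ 2 * ((∑ k, u k ^ 2) * V) := by gcongr
            _ = 4 * V * (∑ k, u k ^ 2) / d ^ 2 := by ring
            _ ≤ _ := by gcongr; linarith

/-- The linear map sending `u` to its inner products with the rows `w i`. -/
noncomputable def rowMap {m d : ℕ} (w : Fin m → EuclideanSpace ℝ (Fin d)) :
    EuclideanSpace ℝ (Fin d) →L[ℝ] EuclideanSpace ℝ (Fin m) :=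
  LinearMap.toContinuousLinearMap (Matrix.toEuclideanLin (Matrix.of fun i k => w i k))

lemma norm_sq_rowMap_apply {m d : ℕ} (w : Fin m → EuclideanSpace ℝ (Fin d))
    (u : EuclideanSpace ℝ (Fin d)) : ‖rowMap w u‖ ^ 2 = ∑ i, (∑ k, w i k * u k) ^ 2 := by
  rw [EuclideanSpace.norm_sq_eq]
  simp [rowMap, Matrix.mulVec, dotProduct]

open scoped Matrix.Norms.L2Operator Matrix in
lemma opNorm_offDiag_gram_le {m d : ℕ} (w : Fin m → EuclideanSpace ℝ (Fin d)) {L : ℝ} (hL : 0 ≤ L)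
    (hw : ∀ i, ‖w i‖ ^ 2 ≤ L) :
    opNorm (Matrix.of fun i j : Fin m => if i = j then 0 else ∑ k, w i k * w j k) ≤
      ‖rowMap w‖ ^ 2 + L := by
  set W : Matrix (Fin m) (Fin d) ℝ := Matrix.of fun i k => w i k
  set A : Matrix (Fin m) (Fin m) ℝ := Matrix.of fun i j => if i = j then 0 else ∑ k, w i k * w j k
  have hA : A = W * Wᴴ - Matrix.diagonal fun i => ‖w i‖ ^ 2 := by
    ext i j
    by_cases h : i = j
    · subst h
      simp [A, W, Matrix.mul_apply, EuclideanSpace.norm_sq_eq, ← sq]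
    · simp [A, W, Matrix.mul_apply, h]
  calc opNorm A = ‖A‖ := rfl
    _ ≤ ‖W * Wᴴ‖ + ‖Matrix.diagonal fun i => ‖w i‖ ^ 2‖ := hA ▸ norm_sub_le _ _
    _ ≤ ‖W‖ * ‖W‖ + L := by
        refine add_le_add ?_ ?_
        · simpa only [Matrix.l2_opNorm_conjTranspose] using Matrix.l2_opNorm_mul W Wᴴ
        · rw [Matrix.l2_opNorm_diagonal]
          exact (pi_norm_le_iff_of_nonneg hL).2 fun i => by simpa using hw i
    _ = ‖rowMap w‖ ^ 2 + L := by rw [← sq]; rfl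

lemma exists_ball_half_opNorm_le {E F : Type*} [NormedAddCommGroup E] [NormedSpace ℝ E]
    [NormedAddCommGroup F] [NormedSpace ℝ F] (T : E →L[ℝ] F) (hT : 0 < ‖T‖) :
    ∃ x : E, ‖x‖ < 1 ∧ ∀ u ∈ ball x (1 / 4), ‖T‖ / 2 ≤ ‖T u‖ := by
  obtain ⟨x, hx, hTx⟩ := T.exists_lt_apply_of_lt_opNorm (r := 3 / 4 * ‖T‖) (by linarith)
  refine ⟨x, hx, fun u hu => ?_⟩
  have h1 : ‖T x‖ ≤ ‖T u‖ + ‖T (u - x)‖ := by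
    have := norm_sub_le (T u) (T (u - x))
    rwa [← map_sub, sub_sub_cancel] at this
  have h2 := T.le_opNorm (u - x)
  rw [mem_ball, dist_eq_norm] at hu
  nlinarith

lemma exp_le_one_add_mul_exp {y b : ℝ} (hy : 0 ≤ y) (hyb : y ≤ b) :
    Real.exp y ≤ 1 + y * Real.exp b := by
  have h1 := Real.add_one_le_exp (-y)
  have h2 : Real.exp y * Real.exp (-y) = 1 := by rw [← Real.exp_add]; simp
  have h3 := Real.exp_le_exp.2 hyb
  nlinarith [Real.exp_pos y]

/-- If `w` has squared norm at most `L` on `G` and second moments at most `σ` there, then the row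
map of `m` independent copies of `w` satisfies an exponential tail bound on the event that all
samples lie in `G`. -/
lemma measure_rowMap_le {Ω : Type*} [MeasurableSpace Ω] (μ : Measure Ω) [IsProbabilityMeasure μ]
    {d : ℕ} {w : Ω → EuclideanSpace ℝ (Fin d)} (hw : Measurable w) {G : Set Ω}
    (hG : MeasurableSet G) {L σ θ : ℝ} (hσ : 0 ≤ σ) (hθ : 0 ≤ θ) (hL : ∀ x ∈ G, ‖w x‖ ^ 2 ≤ L)
    (hmom : ∀ u : EuclideanSpace ℝ (Fin d),
      ∫⁻ x in G, ENNReal.ofReal ((∑ k, w x k * u k) ^ 2) ∂μ ≤ ENNReal.ofReal (σ * ‖u‖ ^ 2)) (m : ℕ) :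
    (Measure.pi fun _ : Fin m => μ)
        {ω | (∀ i, ω i ∈ G) ∧ 1 / 8 < ‖rowMap fun i => w (ω i)‖ ^ 2} ≤
      ENNReal.ofReal (8 ^ d * Real.exp (m * (4 * θ * σ * Real.exp (4 * θ * L)) - θ / 32)) := by
  set P := Measure.pi fun _ : Fin m => μ
  set q : EuclideanSpace ℝ (Fin d) → Ω → ℝ := fun u x => (∑ k, w x k * u k) ^ 2
  have hq : Measurable (Function.uncurry q) := by
    simp only [q, Function.uncurry_def]
    fun_prop
  set φ : EuclideanSpace ℝ (Fin d) → Ω → ℝ≥0∞ := fun u =>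
    G.indicator fun x => ENNReal.ofReal (Real.exp (θ * q u x))
  have hφ : Measurable (Function.uncurry φ) := by
    have h : Function.uncurry φ = (Prod.snd ⁻¹' G).indicator
        fun p => ENNReal.ofReal (Real.exp (θ * Function.uncurry q p)) := by
      ext ⟨u, x⟩
      simp only [φ, Set.indicator, Function.uncurry]
      rfl
    rw [h]
    exact Measurable.indicator (by fun_prop) (measurable_snd hG)
  have hΦ : Measurable fun p : (Fin m → Ω) × EuclideanSpace ℝ (Fin d) => ∏ i, φ p.2 (p.1 i) :=
    Finset.measurable_prod _ fun i _ => hφ.comp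
      (measurable_snd.prodMk ((measurable_pi_apply i).comp measurable_fst))
  set Ψ : (Fin m → Ω) → ℝ≥0∞ := fun ω =>
    ∫⁻ u in ball (0 : EuclideanSpace ℝ (Fin d)) 2, ∏ i, φ u (ω i)
  set V : ℝ≥0∞ := volume (ball (0 : EuclideanSpace ℝ (Fin d)) (1 / 4))
  have hV0 : V ≠ 0 := (measure_ball_pos _ _ (by norm_num)).ne'
  have hVtop : V ≠ ∞ := measure_ball_lt_top.ne
  set B : ℝ := 4 * θ * σ * Real.exp (4 * θ * L)
  have hB : 0 ≤ B := by positivity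
  have hVol : volume (ball (0 : EuclideanSpace ℝ (Fin d)) 2) = ENNReal.ofReal (8 ^ d) * V := by
    have h := Measure.addHaar_ball_mul_of_pos (volume : Measure (EuclideanSpace ℝ (Fin d))) 0
      (r := 8) (by norm_num) (1 / 4)
    norm_num at h
    simpa [V] using h
  have hfactor : ∀ u ∈ ball (0 : EuclideanSpace ℝ (Fin d)) 2,
      ∫⁻ x, φ u x ∂μ ≤ ENNReal.ofReal (Real.exp B) := by
    intro u hu
    have hu2 : ‖u‖ ^ 2 ≤ 4 := by
      rw [mem_ball_zero_iff] at hu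
      nlinarith [norm_nonneg u]
    have hpt : ∀ x ∈ G, Real.exp (θ * q u x) ≤ 1 + θ * Real.exp (4 * θ * L) * q u x := by
      intro x hx
      have hinner : q u x ≤ 4 * L := by
        have h1 : q u x = (inner ℝ (w x) u) ^ 2 := by
          simp only [q, PiLp.inner_apply, RCLike.inner_apply, conj_trivial, mul_comm]
        have h2 : |inner ℝ (w x) u| ≤ ‖w x‖ * ‖u‖ := abs_real_inner_le_norm _ _
        have h3 := pow_le_pow_left₀ (abs_nonneg _) h2 2
        rw [sq_abs, mul_pow] at h3
        have h4 : ‖w x‖ ^ 2 * ‖u‖ ^ 2 ≤ L * 4 :=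
          mul_le_mul (hL x hx) hu2 (sq_nonneg _) ((sq_nonneg _).trans (hL x hx))
        linarith
      have h := exp_le_one_add_mul_exp (y := θ * q u x) (b := 4 * θ * L)
        (mul_nonneg hθ (sq_nonneg _)) (by nlinarith)
      linarith
    have hqu : Measurable (q u) := hq.of_uncurry_left
    calc ∫⁻ x, φ u x ∂μ = ∫⁻ x in G, ENNReal.ofReal (Real.exp (θ * q u x)) ∂μ :=
          lintegral_indicator hG _
      _ ≤ ∫⁻ x in G, (1 + ENNReal.ofReal (θ * Real.exp (4 * θ * L)) * ENNReal.ofReal (q u x)) ∂μ := by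
          refine setLIntegral_mono' hG fun x hx => ?_
          rw [← ENNReal.ofReal_mul (by positivity), ← ENNReal.ofReal_one,
            ← ENNReal.ofReal_add zero_le_one (mul_nonneg (by positivity) (sq_nonneg _))]
          exact ENNReal.ofReal_le_ofReal (hpt x hx)
      _ ≤ 1 + ENNReal.ofReal (θ * Real.exp (4 * θ * L)) * ENNReal.ofReal (σ * ‖u‖ ^ 2) := by
          rw [lintegral_add_left measurable_const, lintegral_const_mul _ (by fun_prop)]
          gcongr
          · simpa using prob_le_one
          · exact hmom u
      _ = ENNReal.ofReal (1 + θ * Real.exp (4 * θ * L) * (σ * ‖u‖ ^ 2)) := by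
          rw [← ENNReal.ofReal_mul (by positivity), ← ENNReal.ofReal_one,
            ← ENNReal.ofReal_add zero_le_one (by positivity)]
      _ ≤ ENNReal.ofReal (Real.exp B) := by
          refine ENNReal.ofReal_le_ofReal ?_
          have h : θ * Real.exp (4 * θ * L) * (σ * ‖u‖ ^ 2) ≤
              θ * Real.exp (4 * θ * L) * (σ * 4) := by gcongr
          have h' := Real.add_one_le_exp B
          simp only [B] at h' ⊢
          linarith
  have hint : ∫⁻ ω, Ψ ω ∂P ≤ ENNReal.ofReal (Real.exp B) ^ m * (ENNReal.ofReal (8 ^ d) * V) := by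
    calc ∫⁻ ω, Ψ ω ∂P = ∫⁻ u in ball (0 : EuclideanSpace ℝ (Fin d)) 2, ∫⁻ ω, ∏ i, φ u (ω i) ∂P :=
          lintegral_lintegral_swap hΦ.aemeasurable
      _ ≤ ∫⁻ _ in ball (0 : EuclideanSpace ℝ (Fin d)) 2, ENNReal.ofReal (Real.exp B) ^ m := by
          refine setLIntegral_mono' measurableSet_ball fun u hu => ?_
          rw [lintegral_pi_prod_eq_prod (fun _ : Fin m => μ) fun _ => hφ.of_uncurry_left]
          calc _ ≤ ∏ _i : Fin m, ENNReal.ofReal (Real.exp B) :=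
                Finset.prod_le_prod' fun i _ => hfactor u hu
            _ = _ := by simp
      _ = _ := by rw [setLIntegral_const, hVol]
  set ε : ℝ≥0∞ := ENNReal.ofReal (Real.exp (θ / 32)) * V
  have hsub : {ω | (∀ i, ω i ∈ G) ∧ 1 / 8 < ‖rowMap fun i => w (ω i)‖ ^ 2} ⊆ {ω | ε ≤ Ψ ω} := by
    rintro ω ⟨hω, hT⟩
    set T := rowMap fun i => w (ω i)
    have hTpos : 0 < ‖T‖ := by
      by_contra h
      have : ‖T‖ = 0 := le_antisymm (not_lt.1 h) (norm_nonneg _)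
      norm_num [this] at hT
    obtain ⟨x, hx, hball⟩ := exists_ball_half_opNorm_le T hTpos
    have hbb : ball x (1 / 4) ⊆ ball (0 : EuclideanSpace ℝ (Fin d)) 2 :=
      ball_subset_ball' (by rw [dist_zero_right]; linarith)
    calc ε = ∫⁻ _ in ball x (1 / 4), ENNReal.ofReal (Real.exp (θ / 32)) := by
          rw [setLIntegral_const, Measure.addHaar_ball_center]
      _ ≤ ∫⁻ u in ball x (1 / 4), ∏ i, φ u (ω i) := by
          refine setLIntegral_mono' measurableSet_ball fun u hu => ?_
          have hprod : ∏ i, φ u (ω i) = ENNReal.ofReal (Real.exp (θ * ‖T u‖ ^ 2)) := by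
            rw [norm_sq_rowMap_apply, Finset.mul_sum, Real.exp_sum,
              ENNReal.ofReal_prod_of_nonneg fun i _ => (Real.exp_pos _).le]
            exact Finset.prod_congr rfl fun i _ => Set.indicator_of_mem (hω i) _
          rw [hprod]
          refine ENNReal.ofReal_le_ofReal (Real.exp_le_exp.2 ?_)
          have h := pow_le_pow_left₀ (by positivity) (hball u hu) 2
          nlinarith
      _ ≤ Ψ ω := lintegral_mono_set hbb
  have hΨ : Measurable Ψ := hΦ.lintegral_prod_right'
  have hε0 : ε ≠ 0 := mul_ne_zero (by simp [Real.exp_pos]) hV0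
  have hεtop : ε ≠ ∞ := ENNReal.mul_ne_top ENNReal.ofReal_ne_top hVtop
  calc P {ω | (∀ i, ω i ∈ G) ∧ 1 / 8 < ‖rowMap fun i => w (ω i)‖ ^ 2}
      ≤ P {ω | ε ≤ Ψ ω} := measure_mono hsub
    _ ≤ (∫⁻ ω, Ψ ω ∂P) / ε := meas_ge_le_lintegral_div hΨ.aemeasurable hε0 hεtop
    _ ≤ ENNReal.ofReal (Real.exp B) ^ m * (ENNReal.ofReal (8 ^ d) * V) / ε := by gcongr
    _ ≤ ENNReal.ofReal (8 ^ d * Real.exp (m * B - θ / 32)) := by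
        refine ENNReal.div_le_of_le_mul (le_of_eq ?_)
        have h : Real.exp B ^ m * 8 ^ d =
            8 ^ d * Real.exp (m * B - θ / 32) * Real.exp (θ / 32) := by
          rw [← Real.exp_nat_mul, mul_assoc, ← Real.exp_add, sub_add_cancel, mul_comm]
        rw [← ENNReal.ofReal_pow (Real.exp_pos _).le, ← mul_assoc,
          ← ENNReal.ofReal_mul (by positivity), h, ENNReal.ofReal_mul (by positivity), mul_assoc]

lemma eventually_dimension_large (C K M : ℝ) {η : ℝ} (hη : 0 < η) :
    ∀ᶠ d : ℕ in Filter.atTop, 1 ≤ d ∧ C ≤ d ∧ 0 < Real.log d ^ 4 ∧ K ≤ η / 2 * Real.log d ^ 4 ∧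
      M ≤ Real.log d ^ 4 ∧ (8 * Real.exp (-3)) ^ d ≤ η / 2 := by
  have hlog : Filter.Tendsto (fun d : ℕ => Real.log d ^ 4) Filter.atTop Filter.atTop :=
    (Filter.tendsto_pow_atTop (by norm_num)).comp
      (Real.tendsto_log_atTop.comp tendsto_natCast_atTop_atTop)
  have hgeo : Filter.Tendsto (fun d : ℕ => (8 * Real.exp (-3)) ^ d) Filter.atTop (nhds 0) := by
    refine tendsto_pow_atTop_nhds_zero_of_lt_one (by positivity) ?_
    have h1 : Real.exp 1 ^ 3 = Real.exp 3 := by rw [← Real.exp_nat_mul]; norm_num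
    have h2 : (2.7 : ℝ) ^ 3 ≤ Real.exp 1 ^ 3 :=
      pow_le_pow_left₀ (by norm_num) (by linarith [Real.exp_one_gt_d9]) 3
    rw [Real.exp_neg, ← div_eq_mul_inv, div_lt_one (Real.exp_pos _)]
    norm_num at h2
    linarith
  filter_upwards [Filter.eventually_ge_atTop 1,
    tendsto_natCast_atTop_atTop.eventually_ge_atTop C, hlog.eventually_gt_atTop 0,
    hlog.eventually_ge_atTop (K / (η / 2)), hlog.eventually_ge_atTop M,
    hgeo.eventually_le_const (half_pos hη)] with d h1 h2 h3 h4 h5 h6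
  exact ⟨h1, h2, h3, by rwa [div_le_iff₀' (half_pos hη)] at h4, h5, h6⟩

lemma measure_exists_notMem_le {Ω : Type*} [MeasurableSpace Ω] (μ : Measure Ω)
    [IsProbabilityMeasure μ] {G : Set Ω} (hG : MeasurableSet G) (m : ℕ) :
    (Measure.pi fun _ : Fin m => μ) {ω | ∃ i, ω i ∉ G} ≤ m * μ Gᶜ := by
  have h : {ω : Fin m → Ω | ∃ i, ω i ∉ G} = ⋃ i, Function.eval i ⁻¹' Gᶜ := by
    ext
    simp
  rw [h]
  refine (measure_iUnion_fintype_le _ _).trans_eq ?_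
  calc ∑ i, (Measure.pi fun _ : Fin m => μ) (Function.eval i ⁻¹' Gᶜ) = ∑ _i : Fin m, μ Gᶜ :=
        Finset.sum_congr rfl fun i _ => (measurePreserving_eval _ i).measure_preimage
          hG.compl.nullMeasurableSet
    _ = m * μ Gᶜ := by simp

/-- There is a universal `c > 0` such that for every `η > 0` there is `d₀` such that for all
`d ≥ d₀` and positive `m ≤ c·d²/log⁴(d)`: if `v⁽¹⁾,…,v⁽ᵐ⁾` are i.i.d. uniform on the sphere
and `A*` is the matrix with zero diagonal and off-diagonal entries
`A*_{ij} = Σ_k ((v⁽ⁱ⁾_k)² − 1/d)((v⁽ʲ⁾_k)² − 1/d)`, then `Pr(‖A*‖₂ ≤ 1/4) ≥ 1 − η`. -/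
theorem A_star_norm_bound :
    ∃ c : ℝ, 0 < c ∧ ∀ η : ℝ, 0 < η → ∃ d₀ : ℕ, ∀ d : ℕ, d₀ ≤ d → ∀ m : ℕ,
      1 ≤ m → (m : ℝ) ≤ c * d ^ 2 / (Real.log d) ^ 4 →
      ENNReal.ofReal (1 - η) ≤
        (Measure.pi fun _ : Fin m => uniformSphere d)
          {v : Fin m → EuclideanSpace ℝ (Fin d) |
            opNorm
              (Matrix.of fun i j : Fin m =>
                if i = j then 0
                else ∑ k, ((v i k) ^ 2 - 1 / (d : ℝ)) * ((v j k) ^ 2 - 1 / (d : ℝ)))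
              ≤ 1 / 4} := by
  obtain ⟨C, K, hC, hK, hgood⟩ := exists_good_event
  refine ⟨1, one_pos, fun η hη => ?_⟩
  obtain ⟨d₀, hd₀⟩ := Filter.eventually_atTop.1
    (eventually_dimension_large (8 * C) K (512 * K * Real.exp (512 * C)) hη)
  refine ⟨d₀, fun d hd m _ hm => ?_⟩
  obtain ⟨hd1, hCd, hlog, hKd, hMd, hgeo⟩ := hd₀ d hd
  obtain ⟨G, hG, hGc, hGL, hGmom⟩ := hgood d hd1
  have hd0 : (0 : ℝ) < d := by exact_mod_cast hd1
  have hmlog : m * Real.log d ^ 4 ≤ (d : ℝ) ^ 2 := by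
    rwa [one_mul, le_div_iff₀ hlog] at hm
  have hm_mul {x y : ℝ} (hy : 0 ≤ y) (hxy : x ≤ y * Real.log d ^ 4) : m * x ≤ y * d ^ 2 := by
    calc (m : ℝ) * x ≤ m * (y * Real.log d ^ 4) := by gcongr
      _ = y * (m * Real.log d ^ 4) := by ring
      _ ≤ y * d ^ 2 := by gcongr
  set P := Measure.pi fun _ : Fin m => stdGaussianPi d
  set w : (Fin d → ℝ) → EuclideanSpace ℝ (Fin d) := fun g => centeredSq (radialProj g)
  set F : (Fin m → Fin d → ℝ) → Fin m → EuclideanSpace ℝ (Fin d) := fun ω i => radialProj (ω i)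
  have hF : Measurable F := measurable_pi_lambda _ fun i =>
    measurable_radialProj.comp (measurable_pi_apply i)
  have hmap : (Measure.pi fun _ : Fin m => uniformSphere d) = P.map F := by
    have : IsProbabilityMeasure ((stdGaussianPi d).map radialProj) :=
      Measure.isProbabilityMeasure_map measurable_radialProj.aemeasurable
    rw [← map_radialProj_stdGaussianPi hd1]
    exact (Measure.pi_map_pi fun _ => measurable_radialProj.aemeasurable).symm
  have hbad : P {ω | ∃ i, ω i ∉ G} ≤ ENNReal.ofReal (η / 2) := by
    refine (measure_exists_notMem_le _ hG m).trans ?_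
    calc (m : ℝ≥0∞) * stdGaussianPi d Gᶜ ≤ ENNReal.ofReal m * ENNReal.ofReal (K / d ^ 2) := by
          rw [ENNReal.ofReal_natCast]
          gcongr
      _ = ENNReal.ofReal (m * (K / d ^ 2)) := (ENNReal.ofReal_mul (by positivity)).symm
      _ ≤ ENNReal.ofReal (η / 2) := by
          refine ENNReal.ofReal_le_ofReal ?_
          rw [← mul_div_assoc, div_le_iff₀ (by positivity)]
          exact hm_mul (half_pos hη).le hKd
  have htail : P {ω | (∀ i, ω i ∈ G) ∧ 1 / 8 < ‖rowMap fun i => w (ω i)‖ ^ 2} ≤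
      ENNReal.ofReal (η / 2) := by
    refine (measure_rowMap_le (stdGaussianPi d) (measurable_centeredSq.comp measurable_radialProj)
      hG (σ := K / d ^ 2) (θ := 128 * d) (by positivity) (by positivity) hGL
      (fun u => (hGmom u).trans_eq (by rw [div_mul_eq_mul_div])) m).trans
      (ENNReal.ofReal_le_ofReal ?_)
    have hexponent : m * (4 * (128 * d) * (K / d ^ 2) * Real.exp (4 * (128 * d) * (C / d))) -
        128 * (d : ℝ) / 32 ≤ d * (-3) := by
      have h1 : 4 * (128 * d) * (C / d) = 512 * C := by field_simp; ring
      have h2 : m * (4 * (128 * d) * (K / d ^ 2) * Real.exp (512 * C)) =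
          m * (512 * K * Real.exp (512 * C)) / d := by field_simp; ring
      have h3 : m * (512 * K * Real.exp (512 * C)) / d ≤ d := by
        rw [div_le_iff₀ hd0]
        linarith [hm_mul zero_le_one (by simpa using hMd)]
      rw [h1, h2]
      linarith
    calc _ ≤ 8 ^ d * Real.exp (d * (-3)) := by gcongr
      _ = (8 * Real.exp (-3)) ^ d := by rw [mul_pow, Real.exp_nat_mul]
      _ ≤ η / 2 := hgeo
  rw [hmap]
  refine le_trans ?_ (Measure.le_map_apply hF.aemeasurable _)
  set S := F ⁻¹' {v : Fin m → EuclideanSpace ℝ (Fin d) |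
            opNorm
              (Matrix.of fun i j : Fin m =>
                if i = j then 0
                else ∑ k, ((v i k) ^ 2 - 1 / (d : ℝ)) * ((v j k) ^ 2 - 1 / (d : ℝ)))
              ≤ 1 / 4}
  have hcover : Set.univ ⊆ S ∪ ({ω | ∃ i, ω i ∉ G} ∪
      {ω | (∀ i, ω i ∈ G) ∧ 1 / 8 < ‖rowMap fun i => w (ω i)‖ ^ 2}) := by
    intro ω _
    by_cases hω : ∀ i, ω i ∈ G
    · by_cases hT : 1 / 8 < ‖rowMap fun i => w (ω i)‖ ^ 2
      · exact Or.inr (Or.inr ⟨hω, hT⟩)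
      · refine Or.inl ?_
        have h := opNorm_offDiag_gram_le (fun i => w (ω i)) (by positivity)
          fun i => hGL (ω i) (hω i)
        have hCd' : C / d ≤ 1 / 8 := by
          rw [div_le_iff₀ hd0]
          linarith
        exact h.trans (by linarith)
    · exact Or.inr (Or.inl (by simpa using hω))
  have hone : 1 ≤ P S + ENNReal.ofReal η := by
    calc 1 = P Set.univ := measure_univ.symm
      _ ≤ P S + (P _ + P _) :=
          (measure_mono hcover).trans <| (measure_union_le _ _).trans <| by
            gcongr
            exact measure_union_le _ _
      _ ≤ P S + (ENNReal.ofReal (η / 2) + ENNReal.ofReal (η / 2)) := by gcongr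
      _ = P S + ENNReal.ofReal η := by
          rw [← ENNReal.ofReal_add (half_pos hη).le (half_pos hη).le, add_halves]
  rw [ENNReal.ofReal_sub _ hη.le, ENNReal.ofReal_one]
  exact tsub_le_iff_right.2 hone
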